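/- arXiv:1105.0185 — 2 statements merged into one kernel-verified Lean document; each statement's English description precedes it below -/
import Mathlib

section
/- If m ≥ 4, then K₊ ∩ ker(ρ) is an irreducible GL_ℂ* module: the only GL_ℂ*-invariant subspaces of K₊ ∩ ker(ρ) are {0} and K₊ ∩ ker(ρ) itself. -/
open Module

variable {V : Type*} [AddCommGroup V] [Module ℝ V]

/-- `A` is an affine curvature operator. -/
def IsAff (A : V →ₗ[ℝ] V →ₗ[ℝ] V →ₗ[ℝ] V) : Prop :=
  (∀ x y, A x y = - A y x) ∧ ∀ x y z, A x y z + A y z x + A z x y = 0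

/-- The Ricci tensor `ρ(A)(x,y) = Tr (z ↦ A(z,x)y)`. -/
noncomputable def rho (A : V →ₗ[ℝ] V →ₗ[ℝ] V →ₗ[ℝ] V) (x y : V) : ℝ :=
  LinearMap.trace ℝ V ((A.flip x).flip y)

/-- `A` is an affine Kähler curvature operator: `A ∈ 𝔄` and `A(x,y)` commutes with `J`. -/
def IsK (J : V →ₗ[ℝ] V) (A : V →ₗ[ℝ] V →ₗ[ℝ] V →ₗ[ℝ] V) : Prop :=
  IsAff A ∧ ∀ x y z, A x y (J z) = J (A x y z)

/-- `A ∈ K₊`. -/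
def IsKplus (J : V →ₗ[ℝ] V) (A : V →ₗ[ℝ] V →ₗ[ℝ] V →ₗ[ℝ] V) : Prop :=
  IsK J A ∧ ∀ x y, A (J x) (J y) = A x y

/-- `g ∈ GL_ℂ*`: `g` commutes or anticommutes with `J`. -/
def IsGLstar (J : V →ₗ[ℝ] V) (g : V ≃ₗ[ℝ] V) : Prop :=
  (∀ v, g (J v) = J (g v)) ∨ (∀ v, g (J v) = - J (g v))



section helpers
open Complex ComplexConjugate
variable {W : Type*} [AddCommGroup W] [Module ℂ W]

lemma polyExtract {M : Type*} [AddCommGroup M] [Module ℂ M] (H : Submodule ℂ M)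
    (c00 c10 c20 c30 c01 c11 c21 c31 : M)
    (h : ∀ s : ℂ, c00 + s • c10 + s ^ 2 • c20 + s ^ 3 • c30 + (conj s) • c01 + (s * conj s) • c11
      + (s ^ 2 * conj s) • c21 + (s ^ 3 * conj s) • c31 ∈ H) : c10 ∈ H ∧ c01 ∈ H := by
  set P : ℂ → M := fun s => c00 + s • c10 + s ^ 2 • c20 + s ^ 3 • c30 + (conj s) • c01
      + (s * conj s) • c11 + (s ^ 2 * conj s) • c21 + (s ^ 3 * conj s) • c31 with hP
  have I2 : I ^ 2 = -1 := I_sq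
  have I3 : I ^ 3 = -I := by rw [pow_succ, I_sq]; ring
  have cI : conj I = -I := conj_I
  have key1 : ∀ r : ℝ, P r - P (-r) - I • P (r * I) + I • P (-(r * I))
      = (4 * (r:ℂ)) • c10 + (4 * (r:ℂ) ^ 3) • c21 := by
    intro r
    simp only [hP, map_neg, map_mul, conj_ofReal, cI, mul_pow, neg_mul, mul_neg, neg_neg, I2, I3,
      smul_add, smul_smul]
    match_scalars <;> ring_nf <;> simp [I2, I3] <;> ring
  have key2 : ∀ r : ℝ, P r - P (-r) + I • P (r * I) - I • P (-(r * I))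
      = (4 * (r:ℂ)) • c01 + (4 * (r:ℂ) ^ 3) • c30 := by
    intro r
    simp only [hP, map_neg, map_mul, conj_ofReal, cI, mul_pow, neg_mul, mul_neg, neg_neg, I2, I3,
      smul_add, smul_smul]
    match_scalars <;> ring_nf <;> simp [I2, I3] <;> ring
  have hP' : ∀ s, P s ∈ H := h
  have m1 : ∀ r : ℝ, (4 * (r:ℂ)) • c10 + (4 * (r:ℂ) ^ 3) • c21 ∈ H := fun r => by
    rw [← key1]
    exact H.add_mem (H.sub_mem (H.sub_mem (hP' _) (hP' _)) (H.smul_mem _ (hP' _)))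
      (H.smul_mem _ (hP' _))
  have m2 : ∀ r : ℝ, (4 * (r:ℂ)) • c01 + (4 * (r:ℂ) ^ 3) • c30 ∈ H := fun r => by
    rw [← key2]
    exact H.sub_mem (H.add_mem (H.sub_mem (hP' _) (hP' _)) (H.smul_mem _ (hP' _)))
      (H.smul_mem _ (hP' _))
  constructor
  · have := H.sub_mem (H.smul_mem (8/24 : ℂ) (m1 1)) (H.smul_mem (1/24 : ℂ) (m1 2))
    convert this using 1
    match_scalars <;> norm_num
  · have := H.sub_mem (H.smul_mem (8/24 : ℂ) (m2 1)) (H.smul_mem (1/24 : ℂ) (m2 2))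
    convert this using 1
    match_scalars <;> norm_num

/-- one plus rank one -/
noncomputable def rankOne (ψ : W →ₗ[ℂ] ℂ) (u : W) (h : 1 + ψ u ≠ 0) : W ≃ₗ[ℂ] W :=
  LinearEquiv.ofLinearMap (LinearMap.id + ψ.smulRight u)
    (LinearMap.id - ((1 + ψ u)⁻¹ • ψ).smulRight u)
    (by ext x; simp only [LinearMap.comp_apply, LinearMap.add_apply, LinearMap.sub_apply,
          LinearMap.id_apply, LinearMap.smulRight_apply, LinearMap.smul_apply, map_sub, map_smul,
          smul_eq_mul]
        match_scalars <;> field_simp <;> ring)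
    (by ext x; simp only [LinearMap.comp_apply, LinearMap.add_apply, LinearMap.sub_apply,
          LinearMap.id_apply, LinearMap.smulRight_apply, LinearMap.smul_apply, map_add, map_smul,
          smul_eq_mul]
        match_scalars <;> field_simp <;> ring)

lemma rankOne_apply (ψ : W →ₗ[ℂ] ℂ) (u : W) (h : 1 + ψ u ≠ 0) (x : W) :
    rankOne ψ u h x = x + ψ x • u := rfl

lemma rankOne_symm_apply (ψ : W →ₗ[ℂ] ℂ) (u : W) (h : 1 + ψ u ≠ 0) (x : W) :
    (rankOne ψ u h).symm x = x - ((1 + ψ u)⁻¹ * ψ x) • u := rfl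

lemma exists_dual_ne {v : W} (hv : v ≠ 0) (c : ℂ) : ∃ ψ : W →ₗ[ℂ] ℂ, ψ v = c := by
  obtain ⟨f, hf⟩ : ∃ f : W →ₗ[ℂ] ℂ, f v ≠ 0 := by
    by_contra! h
    exact hv ((Module.forall_dual_apply_eq_zero_iff ℂ v).1 h)
  exact ⟨(c / f v) • f, by simp [hf]⟩

lemma exists_dual_apply_eq {φ : W →ₗ[ℂ] ℂ} (h : φ ≠ 0) (c : ℂ) : ∃ w, φ w = c := by
  obtain ⟨u, hu⟩ : ∃ u, φ u ≠ 0 := by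
    by_contra! h'
    exact h (LinearMap.ext h')
  exact ⟨(c / φ u) • u, by simp [hu]⟩

lemma transX {v v' : W} (hv : v ≠ 0) (hv' : v' ≠ 0) : ∃ g : W ≃ₗ[ℂ] W, g v = v' := by
  obtain ⟨ψ, h1, h2⟩ : ∃ ψ : W →ₗ[ℂ] ℂ, ψ v = 1 ∧ ψ v' ≠ 0 := by
    obtain ⟨f, hf⟩ := exists_dual_ne hv 1
    obtain ⟨k, hk⟩ := exists_dual_ne hv' 1
    by_cases hfv : f v' = 0
    · by_cases hkv : 1 + k v = 0
      · refine ⟨f + (2:ℂ) • (f + k), ?_, ?_⟩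
        · simp only [LinearMap.add_apply, LinearMap.smul_apply, map_add, map_smul, smul_eq_mul, hf]
          linear_combination 2 * hkv
        · simp [hk, hfv]
      · refine ⟨(1 + k v)⁻¹ • (f + k), ?_, ?_⟩
        · simp only [LinearMap.add_apply, LinearMap.smul_apply, map_add, map_smul, smul_eq_mul, hf]
          field_simp
        · simp [hk, hfv, hkv]
    · exact ⟨f, hf, hfv⟩
  refine ⟨rankOne ψ (v' - v) (by simpa [h1] using h2), ?_⟩
  simp [rankOne_apply, h1]

lemma transY {φ φ' : W →ₗ[ℂ] ℂ} (hφ : φ ≠ 0) (hφ' : φ' ≠ 0) {v : W} (h1 : φ v = 0)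
    (h2 : φ' v = 0) : ∃ g : W ≃ₗ[ℂ] W, g v = v ∧ ∀ x, φ (g.symm x) = φ' x := by
  obtain ⟨u, hu1, hu2⟩ : ∃ u, φ u = 1 ∧ φ' u ≠ 0 := by
    obtain ⟨f, hf⟩ := exists_dual_apply_eq hφ 1
    obtain ⟨k, hk⟩ := exists_dual_apply_eq hφ' 1
    by_cases hfv : φ' f = 0
    · by_cases hkv : 1 + φ k = 0
      · refine ⟨f + (2:ℂ) • (f + k), ?_, ?_⟩
        · simp only [LinearMap.add_apply, LinearMap.smul_apply, map_add, map_smul, smul_eq_mul, hf]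
          linear_combination 2 * hkv
        · simp [hk, hfv]
      · refine ⟨(1 + φ k)⁻¹ • (f + k), ?_, ?_⟩
        · simp only [LinearMap.add_apply, LinearMap.smul_apply, map_add, map_smul, smul_eq_mul, hf]
          field_simp
        · simp [hk, hfv, hkv]
    · exact ⟨f, hf, hfv⟩
  refine ⟨(rankOne (φ' - φ) u (by simpa [hu1] using hu2)).symm, ?_, ?_⟩
  · simp [rankOne_symm_apply, h1, h2]
  · intro x
    simp [rankOne_apply, hu1]

/-- the sesquilinear curvature tensors -/
structure IsR (R : W → W → W → W) : Prop where
  add1 : ∀ x x' y z, R (x + x') y z = R x y z + R x' y z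
  smul1 : ∀ (c : ℂ) x y z, R (c • x) y z = c • R x y z
  add2 : ∀ x y y' z, R x (y + y') z = R x y z + R x y' z
  smul2 : ∀ (c : ℂ) x y z, R x (c • y) z = (conj c) • R x y z
  symm : ∀ x y z, R x y z = R z y x

lemma IsR.add3 {R : W → W → W → W} (h : IsR R) (x y z z') :
    R x y (z + z') = R x y z + R x y z' := by
  rw [h.symm, h.add1, h.symm, h.symm z']

lemma IsR.smul3 {R : W → W → W → W} (h : IsR R) (c : ℂ) (x y z) :
    R x y (c • z) = c • R x y z := by
  rw [h.symm, h.smul1, h.symm]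

lemma step1 {R : W → W → W → W} (hR : IsR R)
    (h : ∀ (φ : W →ₗ[ℂ] ℂ) v, φ v = 0 → φ (R v v v) = 0)
    (φ : W →ₗ[ℂ] ℂ) (v w : W) (hv : φ v = 0) : φ (R v w v) = 0 := by
  by_cases v0 : v = 0
  · subst v0
    have := hR.smul1 0 0 w 0
    simp only [zero_smul] at this
    simp [this]
  obtain ⟨χ, h1, h2⟩ : ∃ χ : W →ₗ[ℂ] ℂ, χ v = - φ w ∧ χ w = 0 := by
    by_cases hw : φ w = 0
    · exact ⟨0, by simp [hw], by simp⟩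
    · obtain ⟨χ, hχ⟩ := exists_dual_ne v0 (-φ w)
      exact ⟨χ - (χ w / φ w) • φ, by simp [hχ, hv], by simp [hw]⟩
  have := (polyExtract (⊥ : Submodule ℂ ℂ) (φ (R v v v))
    (χ (R v v v) + φ (R w v v) + φ (R v v w))
    (χ (R w v v) + χ (R v v w) + φ (R w v w)) (χ (R w v w))
    (φ (R v w v))
    (χ (R v w v) + φ (R w w v) + φ (R v w w))
    (χ (R w w v) + χ (R v w w) + φ (R w w w)) (χ (R w w w)) ?_).2
  · simpa using this
  · intro s
    have := h (φ + s • χ) (v + s • w) (by simp [h1, h2, hv])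
    simp only [hR.add1, hR.add2, hR.add3, hR.smul1, hR.smul2, hR.smul3, LinearMap.add_apply,
      LinearMap.smul_apply, map_add, map_smul, smul_eq_mul] at this
    simp only [Submodule.mem_bot, smul_eq_mul]
    linear_combination this

lemma L1 {ι : Type*} [Fintype ι] [DecidableEq ι] (b : Basis ι ℂ W) {R : W → W → W → W}
    (hR : IsR R) (ht : ∀ y z, ∑ i, b.coord i (R (b i) y z) = 0)
    (h : ∀ (φ : W →ₗ[ℂ] ℂ) v, φ v = 0 → φ (R v v v) = 0) (x y z : W) : R x y z = 0 := by
  have h1 := step1 hR h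
  have hb : ∀ i j, b.coord i (b j) = if i = j then 1 else 0 := by
    intro i j
    simp [Finsupp.single_apply, eq_comm]
  have pol : ∀ (φ χ : W →ₗ[ℂ] ℂ) (v w : W), φ v = 0 → χ v + φ w = 0 → χ w = 0 →
      χ (R v y v) + 2 * φ (R v y w) = 0 := by
    intro φ χ v w e1 e2 e3
    have := (polyExtract (⊥ : Submodule ℂ ℂ) (φ (R v y v))
      (χ (R v y v) + 2 * φ (R v y w))
      (2 * χ (R v y w) + φ (R w y w)) (χ (R w y w)) 0 0 0 0 ?_).1
    · simpa using this
    · intro s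
      have := h1 (φ + s • χ) (v + s • w) y (by
        simp only [map_add, LinearMap.add_apply, LinearMap.smul_apply, map_smul, smul_eq_mul]
        linear_combination e1 + s * e2 + s ^ 2 * e3)
      simp only [hR.add1, hR.add3, hR.smul1, hR.smul3, LinearMap.add_apply, hR.symm w y v,
        LinearMap.smul_apply, map_add, map_smul, smul_eq_mul] at this
      simp only [Submodule.mem_bot, smul_eq_mul]
      linear_combination this
  set a : ι → ℂ := fun k => b.coord k (R (b k) y (b k)) with ha
  have key : ∀ i k l, 2 * b.coord l (R (b i) y (b k))
      = (if l = i then a k else 0) + (if l = k then a i else 0) := by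
    have c1 : ∀ i k, i ≠ k → 2 * b.coord k (R (b i) y (b k)) = a i := by
      intro i k hik
      have := pol (b.coord k) (-b.coord i) (b i) (b k) (by simp only [hb, hik.symm, if_false])
        (by simp only [LinearMap.neg_apply, hb]; simp)
        (by simp only [LinearMap.neg_apply, hb, hik]; simp)
      simp only [LinearMap.neg_apply] at this
      rw [ha]
      linear_combination this
    intro i k l
    by_cases h1 : l = i
    · subst h1
      by_cases h2 : l = k
      · subst h2; simp [ha, two_mul]
      · rw [if_pos rfl, if_neg h2, hR.symm, c1 k l (Ne.symm h2), add_zero]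
    · by_cases h2 : l = k
      · subst h2
        rw [if_neg h1, if_pos rfl, c1 i l (Ne.symm h1), zero_add]
      · rw [if_neg h1, if_neg h2]
        have := pol (b.coord l) 0 (b i) (b k) (by simp only [hb, h1, if_false])
          (by simp only [hb, h2]; simp) (by simp)
        simpa using this
  have a0 : ∀ k, a k = 0 := by
    intro k
    have := ht y (b k)
    have h2 : ∑ i, 2 * b.coord i (R (b i) y (b k)) = 0 := by
      rw [← Finset.mul_sum, this, mul_zero]
    simp only [key, if_true, Finset.sum_add_distrib, Finset.sum_const, Finset.sum_ite_eq',
      Finset.mem_univ, Finset.card_univ, nsmul_eq_mul] at h2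
    have h3 : ((Fintype.card ι + 1 : ℕ) : ℂ) * a k = 0 := by push_cast; linear_combination h2
    exact (mul_eq_zero.1 h3).resolve_left (Nat.cast_ne_zero.2 (Nat.succ_ne_zero _))
  have r0 : ∀ i k, R (b i) y (b k) = 0 := by
    intro i k
    apply b.ext_elem
    intro l
    have := key i k l
    simp only [a0, ite_self, add_zero] at this
    simpa using this
  let B : W →ₗ[ℂ] W →ₗ[ℂ] W := LinearMap.mk₂ ℂ (fun x z => R x y z)
    (fun x x' z => hR.add1 x x' y z) (fun c x z => hR.smul1 c x y z)
    (fun x z z' => hR.add3 x y z z') (fun c x z => hR.smul3 c x y z)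
  have : B = 0 := b.ext fun i => b.ext fun k => r0 i k
  exact congrArg (fun B => B x z) this

/-- elementary tensors -/
def TT (α γ β : W →ₗ[ℂ] ℂ) (v : W) : W → W → W → W :=
  fun x y z => (α x * conj (γ y) * β z) • v

lemma stepA (H : Submodule ℂ (W → W → W → W))
    (hH : ∀ (φ : W →ₗ[ℂ] ℂ) v, φ v = 0 → TT φ φ φ v ∈ H)
    (φ ψ : W →ₗ[ℂ] ℂ) (v : W) (hv : φ v = 0) : TT φ ψ φ v ∈ H := by
  by_cases f0 : φ = 0
  · have : TT φ ψ φ v = 0 := by funext x y z; simp [TT, f0]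
    rw [this]; exact H.zero_mem
  obtain ⟨w, h1, h2⟩ : ∃ w, φ w = - ψ v ∧ ψ w = 0 := by
    by_cases hw : ψ v = 0
    · exact ⟨0, by simp [hw], by simp⟩
    · obtain ⟨w, hχ⟩ := exists_dual_apply_eq f0 (-ψ v)
      exact ⟨w - (ψ w / ψ v) • v, by simp [hχ, hv], by simp [hw]⟩
  refine (polyExtract H (TT φ φ φ v)
    (TT ψ φ φ v + TT φ φ ψ v + TT φ φ φ w)
    (TT ψ φ ψ v + TT ψ φ φ w + TT φ φ ψ w) (TT ψ φ ψ w)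
    (TT φ ψ φ v)
    (TT ψ ψ φ v + TT φ ψ ψ v + TT φ ψ φ w)
    (TT ψ ψ ψ v + TT ψ ψ φ w + TT φ ψ ψ w) (TT ψ ψ ψ w) ?_).2
  intro s
  have := hH (φ + s • ψ) (v + s • w) (by simp [h1, h2, hv])
  convert this using 1
  funext x y z
  simp only [TT, Pi.add_apply, Pi.smul_apply, LinearMap.add_apply, LinearMap.smul_apply,
    smul_eq_mul, map_add, map_mul]
  match_scalars <;> ring

lemma stepB (H : Submodule ℂ (W → W → W → W))
    (hH : ∀ (φ : W →ₗ[ℂ] ℂ) v, φ v = 0 → TT φ φ φ v ∈ H)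
    (φ χ γ : W →ₗ[ℂ] ℂ) (v w : W) (e1 : φ v = 0) (e2 : χ v + φ w = 0) (e3 : χ w = 0) :
    TT χ γ φ v + TT φ γ χ v + TT φ γ φ w ∈ H := by
  refine (polyExtract H (TT φ γ φ v)
    (TT χ γ φ v + TT φ γ χ v + TT φ γ φ w)
    (TT χ γ χ v + TT χ γ φ w + TT φ γ χ w) (TT χ γ χ w) 0 0 0 0 ?_).1
  intro s
  have := stepA H hH (φ + s • χ) γ (v + s • w) (by
        simp only [map_add, LinearMap.add_apply, LinearMap.smul_apply, map_smul, smul_eq_mul]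
        linear_combination e1 + s * e2 + s ^ 2 * e3)
  convert this using 1
  funext x y z
  simp only [TT, Pi.add_apply, Pi.smul_apply, LinearMap.add_apply, LinearMap.smul_apply,
    smul_eq_mul, smul_zero, Pi.zero_apply]
  match_scalars <;> ring

lemma L2 {ι : Type*} [Fintype ι] [DecidableEq ι] (b : Basis ι ℂ W) {R : W → W → W → W}
    (hR : IsR R) (ht : ∀ y z, ∑ i, b.coord i (R (b i) y z) = 0)
    (H : Submodule ℂ (W → W → W → W))
    (hH : ∀ (φ : W →ₗ[ℂ] ℂ) v, φ v = 0 → TT φ φ φ v ∈ H) : R ∈ H := by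
  have hb : ∀ i j, b.coord i (b j) = if i = j then 1 else 0 := by
    intro i j
    simp [Finsupp.single_apply, eq_comm]
  let e : ι → (W →ₗ[ℂ] ℂ) := fun i => b.coord i
  let c : ι → ι → ι → ι → ℂ := fun i j k l => b.coord l (R (b i) (b j) (b k))
  have hc : ∀ i j k l, c i j k l = c k j i l := by
    intro i j k l; simp only [c]; rw [hR.symm]
  have htr : ∀ j k, ∑ i, c i j k i = 0 := fun j k => ht (b j) (b k)
  let S : ι → ι → ι → ι → (W → W → W → W) := fun i j k l =>
    TT (e i) (e j) (e k) (b l) + TT (e k) (e j) (e i) (b l)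
  let Q : ι → ι → (W → W → W → W) := fun j k => TT (e k) (e j) (e k) (b k)
  have key : ∀ i j k l, S i j k l - (if l = i then Q j k else 0) - (if l = k then Q j i else 0)
      ∈ H := by
    have c1 : ∀ j k l, l ≠ k → S l j k l - Q j k ∈ H := by
      intro j k l h
      have := stepB H hH (e k) (-e l) (e j) (b l) (b k) (by simp only [e, hb, h.symm, if_false])
        (by simp only [e, LinearMap.neg_apply, hb]; simp)
        (by simp only [e, LinearMap.neg_apply, hb, h]; simp)
      have h2 := H.neg_mem this
      convert h2 using 1
      funext x y z
      simp only [S, Q, TT, Pi.add_apply, Pi.sub_apply, Pi.neg_apply, LinearMap.neg_apply]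
      match_scalars <;> ring
    have hs : ∀ i j k l, S i j k l = S k j i l := fun i j k l => add_comm _ _
    intro i j k l
    by_cases h1 : l = i
    · subst h1
      by_cases h2 : l = k
      · subst h2
        rw [if_pos rfl]
        have : S l j l l - Q j l - Q j l = 0 := by simp only [S, Q]; abel
        rw [this]; exact H.zero_mem
      · rw [if_pos rfl, if_neg h2, sub_zero]
        exact c1 j k l h2
    · by_cases h2 : l = k
      · subst h2
        rw [if_neg h1, if_pos rfl, sub_zero, hs]
        exact c1 j i l h1
      · rw [if_neg h1, if_neg h2, sub_zero, sub_zero]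
        have := stepB H hH (e i) (e k) (e j) (b l) 0 (by simp only [e, hb, Ne.symm h1, if_false])
          (by simp only [e, hb, Ne.symm h2]; simp) (by simp)
        convert this using 1
        funext x y z
        simp only [S, TT, Pi.add_apply]
        simp [add_comm]
  have hexp : R = ∑ j, ∑ i, ∑ k, ∑ l, c i j k l • TT (e i) (e j) (e k) (b l) := by
    funext x y z
    simp only [Finset.sum_apply, Pi.smul_apply, TT]
    have s1 : ∀ (f : ι → ℂ) y z, R (∑ i, f i • b i) y z = ∑ i, f i • R (b i) y z := by
      intro f y z
      let B : W →ₗ[ℂ] W := ⟨⟨fun x => R x y z, fun x x' => hR.add1 x x' y z⟩,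
        fun c x => hR.smul1 c x y z⟩
      have := map_sum B (fun i => f i • b i) Finset.univ
      simp only [map_smul] at this
      exact this
    have s3 : ∀ (f : ι → ℂ) x y, R x y (∑ i, f i • b i) = ∑ i, f i • R x y (b i) := by
      intro f x y
      rw [hR.symm, s1]
      exact Finset.sum_congr rfl fun i _ => by rw [hR.symm]
    have s2 : ∀ (f : ι → ℂ) x z, R x (∑ i, f i • b i) z = ∑ i, conj (f i) • R x (b i) z := by
      intro f x z
      let B : W →+ W := AddMonoidHom.mk' (fun y => R x y z) (fun y y' => hR.add2 x y y' z)
      have := map_sum B (fun i => f i • b i) Finset.univ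
      simp only [B, AddMonoidHom.mk'_apply, hR.smul2] at this
      exact this
    conv_lhs => rw [← b.sum_repr x, ← b.sum_repr y, ← b.sum_repr z]
    rw [s2]
    refine Finset.sum_congr rfl fun j _ => ?_
    rw [s1, Finset.smul_sum]
    refine Finset.sum_congr rfl fun i _ => ?_
    rw [s3, Finset.smul_sum, Finset.smul_sum]
    refine Finset.sum_congr rfl fun k _ => ?_
    conv_lhs => rw [← b.sum_repr (R (b i) (b j) (b k))]
    simp only [Finset.smul_sum]
    refine Finset.sum_congr rfl fun l _ => ?_
    simp only [smul_smul, c, e, Basis.coord_apply]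
    congr 1
    ring
  rw [hexp]
  refine H.sum_mem fun j _ => ?_
  have h2 : (2:ℂ) • ∑ i, ∑ k, ∑ l, c i j k l • TT (e i) (e j) (e k) (b l)
      = ∑ i, ∑ k, ∑ l, c i j k l • S i j k l := by
    have sw : ∑ i, ∑ k, ∑ l, c i j k l • TT (e k) (e j) (e i) (b l)
        = ∑ i, ∑ k, ∑ l, c i j k l • TT (e i) (e j) (e k) (b l) := by
      rw [Finset.sum_comm]
      refine Finset.sum_congr rfl fun i _ => Finset.sum_congr rfl fun k _ =>
        Finset.sum_congr rfl fun l _ => ?_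
      rw [hc]
    simp only [S, smul_add, Finset.sum_add_distrib]
    rw [sw, two_smul]
  have h3 : ∑ i, ∑ k, ∑ l, c i j k l • S i j k l = ∑ i, ∑ k, ∑ l, c i j k l •
      (S i j k l - (if l = i then Q j k else 0) - (if l = k then Q j i else 0)) := by
    have z1 : ∑ i, ∑ k, ∑ l, c i j k l • (if l = i then Q j k else 0) = 0 := by
      simp only [smul_ite, smul_zero, Finset.sum_ite_eq', Finset.mem_univ, if_true]
      rw [Finset.sum_comm]
      simp only [← Finset.sum_smul, htr, zero_smul, Finset.sum_const_zero]
    have z2 : ∑ i, ∑ k, ∑ l, c i j k l • (if l = k then Q j i else 0) = 0 := by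
      simp only [smul_ite, smul_zero, Finset.sum_ite_eq', Finset.mem_univ, if_true]
      simp only [← Finset.sum_smul]
      refine Finset.sum_eq_zero fun i _ => ?_
      have : ∑ k, c i j k k = 0 := by
        rw [← htr j i]; exact Finset.sum_congr rfl fun k _ => hc _ _ _ _
      rw [this, zero_smul]
    simp only [smul_sub, Finset.sum_sub_distrib]
    rw [z1, z2, sub_zero, sub_zero]
  have h4 : (2:ℂ) • ∑ i, ∑ k, ∑ l, c i j k l • TT (e i) (e j) (e k) (b l) ∈ H := by
    rw [h2, h3]
    exact H.sum_mem fun i _ => H.sum_mem fun k _ => H.sum_mem fun l _ => H.smul_mem _ (key _ _ _ _)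
  exact (H.smul_mem_iff two_ne_zero).1 h4

variable {U : Type*} [AddCommGroup U] [Module ℝ U] [Module ℂ U] [IsScalarTower ℝ ℂ U]

lemma rs (r : ℝ) (w : U) : r • w = (r : ℂ) • w := by
  rw [← Complex.coe_algebraMap, algebraMap_smul]

lemma cs (c : ℂ) (w : U) : c • w = c.re • w + c.im • (I • w) := by
  rw [rs, rs, smul_smul, ← add_smul, Complex.re_add_im]

/-- sesquilinear part of `A` -/
noncomputable def Rof (A : U →ₗ[ℝ] U →ₗ[ℝ] U →ₗ[ℝ] U) (x y z : U) : U :=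
  (1/2 : ℂ) • (A x y z - I • A (I • x) y z)

section
variable {J : U →ₗ[ℝ] U} (hJ : ∀ v, J v = I • v) {A : U →ₗ[ℝ] U →ₗ[ℝ] U →ₗ[ℝ] U}
  (hA : IsKplus J A)
include hJ hA

lemma A_I3 (x y z : U) : A x y (I • z) = I • A x y z := by
  rw [← hJ, ← hJ]; exact hA.1.2 x y z

lemma A_I2 (x y z : U) : A x (I • y) z = - A (I • x) y z := by
  have := hA.2 x (I • y)
  rw [hJ, hJ, smul_smul, I_mul_I, neg_one_smul, map_neg] at this
  rw [← this]; rfl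

lemma A_I1 (x y z : U) : A (I • x) (I • y) z = A x y z := by
  have := hA.2 x y
  rw [hJ, hJ] at this
  rw [this]

lemma A_sk (x y z : U) : A x y z = - A y x z := by
  have := hA.1.1.1 x y
  rw [this]; rfl

lemma Rof_isR : IsR (Rof A) where
  add1 x x' y z := by
    simp only [Rof, smul_add, map_add, LinearMap.add_apply]; module
  add2 x y y' z := by
    simp only [Rof, map_add, LinearMap.add_apply]; module
  smul1 c x y z := by
    have e : I • (c • x) = (-c.im) • x + c.re • (I • x) := by
      rw [rs, rs, smul_smul, smul_smul, ← add_smul]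
      congr 1
      apply Complex.ext <;> simp
    simp only [Rof]
    rw [e, cs c x]
    simp only [map_add, map_smul, LinearMap.add_apply, LinearMap.smul_apply]
    simp only [rs]
    conv_rhs => rw [← Complex.re_add_im c]
    match_scalars
    · push_cast; ring
    · push_cast; linear_combination (1/2 : ℂ) * c.im * I_sq
  smul2 c x y z := by
    have e : conj c = c.re - c.im * I := by
      apply Complex.ext <;> simp
    simp only [Rof]
    rw [cs c y, e]
    simp only [map_add, map_smul, LinearMap.add_apply, LinearMap.smul_apply, A_I2 hJ hA]
    rw [smul_smul I I x, I_mul_I]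
    simp only [neg_one_smul, map_neg, LinearMap.neg_apply, rs]
    match_scalars
    · push_cast; ring
    · push_cast; linear_combination (-1/2 : ℂ) * c.im * I_sq
  symm x y z := by
    have b := hA.1.1.2
    have b1 := b x y z
    have b2 := b (I • x) y (I • z)
    rw [A_I3 hJ hA, A_I3 hJ hA, A_sk hJ hA y (I • z) x, A_I1 hJ hA] at b2
    rw [A_sk hJ hA y z x] at b1
    have b3 : A z x y = A z y x - A x y z := by
      rw [← sub_eq_zero, ← b1]; abel
    rw [b3] at b2
    have b4 : I • A (I • x) y z - I • A (I • z) y x = A x y z - A z y x := by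
      rw [← sub_eq_zero, ← b2]; module
    have b5 : I • A (I • x) y z = I • A (I • z) y x + A x y z - A z y x := by
      rw [← sub_eq_zero, ← sub_eq_zero.2 b4]; abel
    simp only [Rof]
    rw [b5]
    congr 1
    abel

lemma A_eq (x y z : U) : A x y z = Rof A x y z - Rof A y x z := by
  have h1 : A (I • y) x z = A (I • x) y z := by
    rw [A_sk hJ hA, A_I2 hJ hA, neg_neg]
  simp only [Rof]
  rw [h1, A_sk hJ hA y x z]
  module

omit hJ hA in
lemma rho_eq {ι : Type*} [Fintype ι] [DecidableEq ι] (b : Basis ι ℂ U) (x y : U) :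
    rho A x y = 2 * (∑ i, b.coord i (Rof A (b i) x y)).re := by
  rw [rho, LinearMap.trace_eq_matrix_trace ℝ (Complex.basisOneI.smulTower b), Matrix.trace,
    Fintype.sum_prod_type, Fin.sum_univ_two, ← Finset.sum_add_distrib, Complex.re_sum,
    Finset.mul_sum]
  refine Finset.sum_congr rfl fun i _ => ?_
  simp only [Matrix.diag_apply, LinearMap.toMatrix_apply, Basis.smulTower_repr_mk,
    Basis.smulTower_apply, Complex.coe_basisOneI_repr, Complex.coe_basisOneI]
  simp [Rof]

lemma trace_zero (hr : ∀ x y, rho A x y = 0) {ι : Type*} [Fintype ι] [DecidableEq ι]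
    (b : Basis ι ℂ U) (y z : U) : ∑ i, b.coord i (Rof A (b i) y z) = 0 := by
  have h1 := hr y z
  have h2 := hr y (I • z)
  rw [rho_eq b] at h1 h2
  simp only [(Rof_isR hJ hA).smul3, map_smul, smul_eq_mul, ← Finset.mul_sum] at h2
  apply Complex.ext
  · simpa using h1
  · simpa using h2

end

/-- conjugation action -/
noncomputable def cj (g : U ≃ₗ[ℝ] U) (A : U →ₗ[ℝ] U →ₗ[ℝ] U →ₗ[ℝ] U) :
    U →ₗ[ℝ] U →ₗ[ℝ] U →ₗ[ℝ] U :=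
  LinearMap.mk₂ ℝ (fun x y => g.toLinearMap ∘ₗ (A (g.symm x) (g.symm y)) ∘ₗ g.symm.toLinearMap)
    (by intros; ext; simp) (by intros; ext; simp) (by intros; ext; simp) (by intros; ext; simp)

theorem mainC [FiniteDimensional ℂ U] (J : U →ₗ[ℝ] U) (hJ : ∀ v, J v = I • v)
    (ξ : Submodule ℝ (U →ₗ[ℝ] U →ₗ[ℝ] U →ₗ[ℝ] U))
    (h1 : ∀ A ∈ ξ, IsKplus J A ∧ ∀ x y, rho A x y = 0)
    (h2 : ∀ g : U ≃ₗ[ℝ] U, IsGLstar J g → ∀ A ∈ ξ, ∀ B : U →ₗ[ℝ] U →ₗ[ℝ] U →ₗ[ℝ] U,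
        (∀ x y z, B x y z = g (A (g.symm x) (g.symm y) (g.symm z))) → B ∈ ξ) :
      ξ = ⊥ ∨ ∀ A : U →ₗ[ℝ] U →ₗ[ℝ] U →ₗ[ℝ] U,
        IsKplus J A → (∀ x y, rho A x y = 0) → A ∈ ξ := by
  have hg : ∀ g : U ≃ₗ[ℂ] U, ∀ A ∈ ξ, ∃ B ∈ ξ,
      ∀ x y z, B x y z = g (A (g.symm x) (g.symm y) (g.symm z)) := by
    intro g A hA
    exact ⟨cj (g.restrictScalars ℝ) A, h2 (g.restrictScalars ℝ) (Or.inl fun v => by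
      rw [hJ, hJ]; exact map_smul g I v) A hA _ fun x y z => rfl, fun x y z => rfl⟩
  let b := Module.finBasis ℂ U
  by_cases hb : ξ = ⊥
  · exact Or.inl hb
  right
  obtain ⟨A, hA, A0⟩ := (Submodule.ne_bot_iff ξ).1 hb
  obtain ⟨hK, hr⟩ := h1 A hA
  have hR := Rof_isR hJ hK
  obtain ⟨φ, v, hv, hc⟩ : ∃ (φ : U →ₗ[ℂ] ℂ) (v : U), φ v = 0 ∧ φ (Rof A v v v) ≠ 0 := by
    by_contra! hcon
    have := L1 b hR (trace_zero hJ hK hr b) hcon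
    apply A0
    ext x y z
    rw [A_eq hJ hK, this, this]; simp
  set c := φ (Rof A v v v) with hcdef
  -- highest vector
  let In : (U → U → U → U) → Prop := fun f => ∃ B ∈ ξ, ∀ x y z, B x y z = f x y z - f y x z
  have In1 : In (TT φ φ φ (c • v)) := by
    let N : U →ₗ[ℝ] U := (φ.smulRight v).restrictScalars ℝ
    have ht : ∀ t : ℝ, ∃ B ∈ ξ, ∀ x y z, B x y z =
        A (x - t • N x) (y - t • N y) (z - t • N z)
          + t • N (A (x - t • N x) (y - t • N y) (z - t • N z)) := by
      intro t
      have hu : 1 + ((t : ℂ) • φ) v ≠ 0 := by simp [hv]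
      obtain ⟨B, hB, e⟩ := hg (rankOne ((t : ℂ) • φ) v hu) A hA
      refine ⟨B, hB, fun x y z => ?_⟩
      rw [e]
      have s : ∀ x, (rankOne ((t : ℂ) • φ) v hu).symm x = x - t • N x := by
        intro x
        rw [rankOne_symm_apply, rs]
        simp [N, hv, smul_smul]
      rw [s, s, s, rankOne_apply]
      generalize A (x - t • N x) (y - t • N y) (z - t • N z) = q
      rw [rs]
      simp [N, smul_smul]
    obtain ⟨B1, m1, e1⟩ := ht 1
    obtain ⟨B2, m2, e2⟩ := ht 2
    obtain ⟨B3, m3, e3⟩ := ht (-1)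
    obtain ⟨B4, m4, e4⟩ := ht (-2)
    refine ⟨(-1/24 : ℝ) • (B2 + (-4:ℝ) • B1 + (6:ℝ) • A + (-4:ℝ) • B3 + B4), ?_, ?_⟩
    · exact ξ.smul_mem _ (ξ.add_mem (ξ.add_mem (ξ.add_mem (ξ.add_mem m2 (ξ.smul_mem _ m1))
        (ξ.smul_mem _ hA)) (ξ.smul_mem _ m3)) m4)
    · intro x y z
      have key : ((-1/24 : ℝ) • (B2 + (-4:ℝ) • B1 + (6:ℝ) • A + (-4:ℝ) • B3 + B4)) x y z
          = N (A (N x) (N y) (N z)) := by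
        simp only [LinearMap.smul_apply, LinearMap.add_apply, LinearMap.sub_apply, e1, e2, e3, e4,
          map_sub, map_smul]
        module
      rw [key]
      simp only [N, LinearMap.restrictScalars_apply, LinearMap.smulRight_apply]
      rw [A_eq hJ hK]
      simp only [hR.smul1, hR.smul2, hR.smul3, map_sub, map_smul, smul_eq_mul, ← hcdef, TT]
      match_scalars
      ring
  have Ing : ∀ (g : U ≃ₗ[ℂ] U) (φ' : U →ₗ[ℂ] ℂ) (v' : U), In (TT φ' φ' φ' v') →
      In (TT (φ' ∘ₗ g.symm.toLinearMap) (φ' ∘ₗ g.symm.toLinearMap) (φ' ∘ₗ g.symm.toLinearMap)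
        (g v')) := by
    rintro g φ' v' ⟨B, hB, e⟩
    obtain ⟨B', hB', e'⟩ := hg g B hB
    refine ⟨B', hB', fun x y z => ?_⟩
    rw [e', e]
    simp [TT]
  have φ0 : φ ≠ 0 := by
    rintro rfl
    exact hc rfl
  have v0 : c • v ≠ 0 := by
    intro h
    rcases smul_eq_zero.1 h with h | h
    · exact hc h
    · apply hc
      have := hR.smul1 0 v v v
      rw [zero_smul, zero_smul] at this
      rw [hcdef, show Rof A v v v = 0 by rw [← this, h]]
      simp
  have InAll : ∀ (φ' : U →ₗ[ℂ] ℂ) (v' : U), φ' v' = 0 → In (TT φ' φ' φ' v') := by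
    intro φ' v' hv'
    by_cases z1 : φ' = 0
    · exact ⟨0, ξ.zero_mem, fun x y z => by simp [TT, z1]⟩
    by_cases z2 : v' = 0
    · exact ⟨0, ξ.zero_mem, fun x y z => by simp [TT, z2]⟩
    obtain ⟨g, hg1⟩ := transX v0 z2
    have In2 := Ing g _ _ In1
    rw [hg1] at In2
    have n1 : φ ∘ₗ g.symm.toLinearMap ≠ 0 := by
      intro h
      apply φ0
      ext x
      have := congrArg (fun f => f (g x)) h
      simpa using this
    obtain ⟨k, hk1, hk2⟩ := transY n1 z1 (v := v')
      (by rw [← hg1]; simp [hv]) hv'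
    have In3 := Ing k _ _ In2
    rw [hk1] at In3
    have : (φ ∘ₗ g.symm.toLinearMap) ∘ₗ k.symm.toLinearMap = φ' := LinearMap.ext hk2
    rwa [this] at In3
  let H : Submodule ℂ (U → U → U → U) :=
    { carrier := {f | ∀ c : ℂ, In (c • f)}
      zero_mem' := fun c => ⟨0, ξ.zero_mem, fun x y z => by simp⟩
      add_mem' := by
        intro f f' hf hf' c
        obtain ⟨B, m, e⟩ := hf c
        obtain ⟨B', m', e'⟩ := hf' c
        refine ⟨B + B', ξ.add_mem m m', fun x y z => ?_⟩
        simp only [LinearMap.add_apply, e, e', Pi.add_apply, Pi.smul_apply]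
        module
      smul_mem' := by
        intro d f hf c
        rw [smul_smul]
        exact hf (c * d) }
  have hH : ∀ (φ : U →ₗ[ℂ] ℂ) v, φ v = 0 → TT φ φ φ v ∈ H := by
    intro φ v hv c
    have := InAll φ (c • v) (by simp [hv])
    have e : TT φ φ φ (c • v) = c • TT φ φ φ v := by
      funext x y z
      simp only [TT, Pi.smul_apply]
      module
    rwa [e] at this
  intro A' hA' hr'
  obtain ⟨B, m, e⟩ := L2 b (Rof_isR hJ hA') (trace_zero hJ hA' hr' b) H hH 1
  have : A' = B := by
    ext x y z
    rw [e, A_eq hJ hA']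
    simp
  rwa [this]

end helpers

/-- if `m ≥ 4`, then `K₊ ∩ ker ρ` is an irreducible `GL_ℂ*` module. -/
theorem statement1 [FiniteDimensional ℝ V] (J : V →ₗ[ℝ] V) (hJ : ∀ v, J (J v) = -v)
    (hm : 4 ≤ finrank ℝ V) :
    ∀ ξ : Submodule ℝ (V →ₗ[ℝ] V →ₗ[ℝ] V →ₗ[ℝ] V),
      (∀ A ∈ ξ, IsKplus J A ∧ ∀ x y, rho A x y = 0) →
      (∀ g : V ≃ₗ[ℝ] V, IsGLstar J g → ∀ A ∈ ξ, ∀ B : V →ₗ[ℝ] V →ₗ[ℝ] V →ₗ[ℝ] V,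
        (∀ x y z, B x y z = g (A (g.symm x) (g.symm y) (g.symm z))) → B ∈ ξ) →
      ξ = ⊥ ∨ ∀ A : V →ₗ[ℝ] V →ₗ[ℝ] V →ₗ[ℝ] V,
        IsKplus J A → (∀ x y, rho A x y = 0) → A ∈ ξ := by
  classical
  let f : ℂ →ₐ[ℝ] Module.End ℝ V := Complex.lift ⟨J, by
    ext v; simp [hJ]⟩
  letI : Module ℂ V := Module.compHom V f.toRingHom
  have hsm : ∀ (c : ℂ) (v : V), c • v = f c v := fun c v => rfl
  haveI : IsScalarTower ℝ ℂ V := ⟨fun r c v => by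
    rw [hsm, hsm, map_smul]; rfl⟩
  haveI : FiniteDimensional ℂ V := FiniteDimensional.right ℝ ℂ V
  intro ξ h1 h2
  exact mainC J (fun v => by rw [hsm]; simp [f]) ξ h1 h2
end

section
/- For every φ ∈ S²₊, the operator σ₁φ belongs to K₊ (i.e., σ₁φ is an affine curvature operator, commutes with J, and satisfies (σ₁φ)(Jx,Jy) = (σ₁φ)(x,y)), and ρ(σ₁φ) = -(m+2)φ. -/
open Module

variable {V : Type*} [AddCommGroup V] [Module ℝ V]

theorem trace_J_zero {W : Type*} [AddCommGroup W] [Module ℝ W] [FiniteDimensional ℝ W]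
    (J : W →ₗ[ℝ] W) (hJ : ∀ v, J (J v) = -v) : LinearMap.trace ℝ W J = 0 := by
  have hJ2 : J * J = -1 := by ext v; simp [hJ]
  let f : ℂ →ₐ[ℝ] Module.End ℝ W := Complex.lift ⟨J, hJ2⟩
  let : Module ℂ W := Module.compHom W (f : ℂ →+* Module.End ℝ W)
  have hs : ∀ (c : ℂ) (w : W), c • w = f c w := fun _ _ => rfl
  have : IsScalarTower ℝ ℂ W := ⟨fun r c w => by simp [hs]⟩
  have : FiniteDimensional ℂ W := FiniteDimensional.right ℝ ℂ W
  have hJe : ∀ v : W, J v = Complex.I • v := fun v => by simp [hs, f]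
  let c := Module.finBasis ℂ W
  rw [LinearMap.trace_eq_matrix_trace ℝ (Complex.basisOneI.smulTower c), Matrix.trace]
  refine Finset.sum_eq_zero fun ij _ => ?_
  obtain ⟨i, j⟩ := ij
  rw [Matrix.diag_apply, LinearMap.toMatrix_apply, Module.Basis.smulTower_repr,
    Module.Basis.smulTower_apply, hJe, smul_smul, map_smul, Module.Basis.repr_self]
  fin_cases i <;> simp

/-- for `φ ∈ S²₊`, `σ₁φ ∈ K₊` and `ρ(σ₁φ) = -(m+2)φ`. -/
theorem statement6 [FiniteDimensional ℝ V] (J : V →ₗ[ℝ] V) (hJ : ∀ v, J (J v) = -v)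
    (φ : V →ₗ[ℝ] V →ₗ[ℝ] ℝ) (hsym : ∀ x y, φ x y = φ y x) (hJφ : ∀ x y, φ (J x) (J y) = φ x y)
    (S : V →ₗ[ℝ] V →ₗ[ℝ] V →ₗ[ℝ] V)
    (hS : ∀ x y z, S x y z = φ x z • y - φ y z • x - φ x (J z) • J y + φ y (J z) • J x - (2 * φ x (J y)) • J z) :
    IsKplus J S ∧ ∀ x y, rho S x y = (-((finrank ℝ V : ℝ) + 2)) * φ x y := by
  have h1 : ∀ x y, φ (J x) y = - φ x (J y) := fun x y => by
    have := hJφ x (J y)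
    rw [hJ, map_neg] at this
    linarith
  have h2 : ∀ x y, φ x (J y) = - φ y (J x) := fun x y => by
    rw [hsym, h1]
  refine ⟨⟨⟨⟨fun x y => ?_, fun x y z => ?_⟩, fun x y z => ?_⟩, fun x y => ?_⟩, fun x y => ?_⟩
  · ext z
    rw [LinearMap.neg_apply, hS, hS, h2 y x]
    module
  · rw [hS, hS, hS, h2 y x, h2 z x, h2 z y, hsym y x, hsym z x, hsym z y]
    module
  · simp only [hS, hJ, map_add, map_sub, map_smul, map_neg]
    module
  · ext z
    simp only [hS, hJ, hJφ, h1, map_neg]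
    module
  · have hE : (S.flip x).flip y = (φ.flip y).smulRight x - φ x y • LinearMap.id
        - (φ.flip (J y)).smulRight (J x) + φ x (J y) • J
        - (2 : ℝ) • ((φ.flip (J x)).smulRight (J y)) := by
      ext z
      simp [hS, smul_smul]
    unfold rho
    rw [hE]
    simp only [map_add, map_sub, map_smul, LinearMap.trace_smulRight, LinearMap.trace_id,
      trace_J_zero J hJ, LinearMap.flip_apply, hJφ, smul_eq_mul, hsym y x]
    ring
end
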